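/- Let T > 0, C ∈ ℝ, and let y : [0,∞) → ℝ be a C¹ function with y(z) ≠ 0 for all z. Define, for 0 ≤ t < T/C (or all t if C ≤ 0) and r > 0, ρ(t,r) = 1 / ((T - C t)² y(r/(T - C t))²) and u(t,r) = -C r / (T - C t). Then ρ and u satisfy the radially symmetric continuity equation ρ_t + u ρ_r + ρ u_r + (1/r) ρ u = 0. -/

import Mathlib

open Set

theorem stmt4 (T C : ℝ) (hT : 0 < T) (y : ℝ → ℝ)
    (hy : ContDiff ℝ 1 y) (hy0 : ∀ z, y z ≠ 0)
    (ρ u : ℝ → ℝ → ℝ)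
    (hρ : ∀ t r, ρ t r = 1 / ((T - C * t) ^ 2 * (y (r / (T - C * t))) ^ 2))
    (hu : ∀ t r, u t r = -C * r / (T - C * t)) :
    ∀ t r, 0 < T - C * t → 0 < r →
      deriv (fun τ => ρ τ r) t + u t r * deriv (fun s => ρ t s) r +
        ρ t r * deriv (fun s => u t s) r + (1 / r) * ρ t r * u t r = 0 := by
  intro t r hL hr
  simp only [hρ, hu]
  have hL0 : T - C * t ≠ 0 := hL.ne'
  have hyz := hy0 (r / (T - C * t))
  have hy' : HasDerivAt y (deriv y (r / (T - C * t))) (r / (T - C * t)) :=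
    (hy.differentiable one_ne_zero _).hasDerivAt
  have hden : (T - C * t) ^ 2 * y (r / (T - C * t)) ^ 2 ≠ 0 := by positivity
  have hLt : HasDerivAt (fun τ => T - C * τ) (-C) t := by
    simpa using ((hasDerivAt_id t).const_mul C).const_sub T
  have hyt := hy'.comp t ((hasDerivAt_const t r).div hLt hL0)
  have hyr := hy'.comp r ((hasDerivAt_id r).div_const (T - C * t))
  have hρt : HasDerivAt (fun τ => 1 / ((T - C * τ) ^ 2 * y (r / (T - C * τ)) ^ 2)) _ t :=
    (hasDerivAt_const t (1 : ℝ)).div ((hLt.pow 2).mul (hyt.pow 2)) hden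
  have hρr : HasDerivAt (fun s => 1 / ((T - C * t) ^ 2 * y (s / (T - C * t)) ^ 2)) _ r :=
    (hasDerivAt_const r (1 : ℝ)).div ((hyr.pow 2).const_mul ((T - C * t) ^ 2)) hden
  have hur : HasDerivAt (fun s => -C * s / (T - C * t)) _ r :=
    ((hasDerivAt_id r).const_mul (-C)).div_const (T - C * t)
  rw [hρt.deriv, hρr.deriv, hur.deriv]
  simp only [Function.comp_apply, Pi.pow_apply, Pi.div_apply, id]
  generalize deriv y (r / (T - C * t)) = y'
  generalize y (r / (T - C * t)) = Y at *
  generalize T - C * t = L at *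
  field_simp
  ring
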